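/- There exists a universal constant N₄∈(0,1) such that the following holds. Let (u,Π) be a classical axisymmetric solution of the 3D Navier–Stokes equations on Q(1), let 0<R≤1/4 with J_R>0, and let h be the associated normalized function. Then R^{−5}·∫_{−R²}^{−R²/4}∫_{B(R/2)} h(x,t) dx dt ≥ N₄·(1+A(R))^{−1}. -/

import Mathlib

open Real MeasureTheory Set
open scoped ENNReal
noncomputable section

abbrev E3 := EuclideanSpace ℝ (Fin 3)

/-- `i`-th standard basis vector of `ℝ³`. -/
def ee (i : Fin 3) : E3 := EuclideanSpace.single i 1

/-- partial derivative of a scalar function in the direction `eᵢ`. -/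
def pd (f : E3 → ℝ) (i : Fin 3) (x : E3) : ℝ := fderiv ℝ f x (ee i)

/-- Laplacian of a scalar function. -/
def lap (f : E3 → ℝ) (x : E3) : ℝ := ∑ i, pd (fun y => pd f i y) i x

/-- parabolic cylinder `Q(z₀,R) = B(x₀,R) × (t₀ - R², t₀)`. -/
def Qyl (z₀ : E3 × ℝ) (R : ℝ) : Set (E3 × ℝ) :=
  (Metric.ball z₀.1 R) ×ˢ (Ioo (z₀.2 - R ^ 2) z₀.2)

/-- `(u, P)` is a classical solution of the 3D Navier–Stokes equations on the open set `U`,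
which contains the closure of `Q(1)`. -/
structure IsNSQ1 (u : E3 → ℝ → E3) (P : E3 → ℝ → ℝ) (U : Set (E3 × ℝ)) : Prop where
  open_U : IsOpen U
  subset_U : closure (Qyl (0, 0) 1) ⊆ U
  smooth_u : ContDiffOn ℝ (⊤ : ℕ∞) (fun z : E3 × ℝ => u z.1 z.2) U
  smooth_P : ContDiffOn ℝ (⊤ : ℕ∞) (fun z : E3 × ℝ => P z.1 z.2) U
  momentum : ∀ x : E3, ∀ t : ℝ, (x, t) ∈ U → ∀ j : Fin 3,
    deriv (fun s => u x s j) t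
      + (∑ i, u x t i * pd (fun y => u y t j) i x)
      - lap (fun y => u y t j) x
      + pd (fun y => P y t) j x = 0
  divfree : ∀ x : E3, ∀ t : ℝ, (x, t) ∈ U → ∑ i, pd (fun y => u y t i) i x = 0

/-- `(u, P)` is axially symmetric on `U`: in cylindrical coordinates
`u = uʳ eᵣ + uᶿ e_θ + u³ e₃` and `P = p(r, x₃, t)`. -/
def IsAxisym (u : E3 → ℝ → E3) (P : E3 → ℝ → ℝ) (U : Set (E3 × ℝ)) : Prop :=
  ∃ ur uθ u3 pp : ℝ → ℝ → ℝ → ℝ,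
    ∀ x : E3, ∀ t : ℝ, (x, t) ∈ U → x 0 ^ 2 + x 1 ^ 2 ≠ 0 →
      u x t 0 = ur (Real.sqrt (x 0 ^ 2 + x 1 ^ 2)) (x 2) t
                  * (x 0 / Real.sqrt (x 0 ^ 2 + x 1 ^ 2))
                - uθ (Real.sqrt (x 0 ^ 2 + x 1 ^ 2)) (x 2) t
                  * (x 1 / Real.sqrt (x 0 ^ 2 + x 1 ^ 2)) ∧
      u x t 1 = ur (Real.sqrt (x 0 ^ 2 + x 1 ^ 2)) (x 2) t
                  * (x 1 / Real.sqrt (x 0 ^ 2 + x 1 ^ 2))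
                + uθ (Real.sqrt (x 0 ^ 2 + x 1 ^ 2)) (x 2) t
                  * (x 0 / Real.sqrt (x 0 ^ 2 + x 1 ^ 2)) ∧
      u x t 2 = u3 (Real.sqrt (x 0 ^ 2 + x 1 ^ 2)) (x 2) t ∧
      P x t = pp (Real.sqrt (x 0 ^ 2 + x 1 ^ 2)) (x 2) t

/-- `Γ = r uᶿ = x₁ u₂ - x₂ u₁`. -/
def Gam (u : E3 → ℝ → E3) (x : E3) (t : ℝ) : ℝ := x 0 * u x t 1 - x 1 * u x t 0

/-- Cartesian components of `b = uʳ eᵣ + u³ e₃ = u - uᶿ e_θ`. -/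
def bcomp (u : E3 → ℝ → E3) (x : E3) (t : ℝ) : Fin 3 → ℝ :=
  ![u x t 0 + x 1 * Gam u x t / (x 0 ^ 2 + x 1 ^ 2),
    u x t 1 - x 0 * Gam u x t / (x 0 ^ 2 + x 1 ^ 2),
    u x t 2]

/-- Euclidean norm of `b`. -/
def bnorm (u : E3 → ℝ → E3) (x : E3) (t : ℝ) : ℝ :=
  Real.sqrt (∑ i, (bcomp u x t i) ^ 2)

/-- `A(z₀,R)`. -/
def AA (u : E3 → ℝ → E3) (z₀ : E3 × ℝ) (R : ℝ) : ℝ :=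
  ⨆ t ∈ Ioo (z₀.2 - R ^ 2) z₀.2, R⁻¹ * ∫ x in Metric.ball z₀.1 R, ‖u x t‖ ^ 2

/-- `E(z₀,R)`. -/
def EE (u : E3 → ℝ → E3) (z₀ : E3 × ℝ) (R : ℝ) : ℝ :=
  R⁻¹ * ∫ t in Ioo (z₀.2 - R ^ 2) z₀.2, ∫ x in Metric.ball z₀.1 R,
    ∑ j, ∑ i, (pd (fun y => u y t j) i x) ^ 2

/-- `C(z₀,R)`. -/
def CC (u : E3 → ℝ → E3) (z₀ : E3 × ℝ) (R : ℝ) : ℝ :=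
  (R ^ 2)⁻¹ * ∫ t in Ioo (z₀.2 - R ^ 2) z₀.2, ∫ x in Metric.ball z₀.1 R, ‖u x t‖ ^ 3

/-- `D(z₀,R)`. -/
def DD (P : E3 → ℝ → ℝ) (z₀ : E3 × ℝ) (R : ℝ) : ℝ :=
  (R ^ 2)⁻¹ * ∫ t in Ioo (z₀.2 - R ^ 2) z₀.2, ∫ x in Metric.ball z₀.1 R, |P x t| ^ (3/2 : ℝ)

/-- `𝓔(z₀,R) = A + E + D`. -/
def EEE (u : E3 → ℝ → E3) (P : E3 → ℝ → ℝ) (z₀ : E3 × ℝ) (R : ℝ) : ℝ :=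
  AA u z₀ R + EE u z₀ R + DD P z₀ R

/-- the weight `ω(R) = (ln ln (100/R))⁻¹`. -/
def omg (R : ℝ) : ℝ := (Real.log (Real.log (100 / R)))⁻¹

/-- `G(z₀,R) = R^{1-3/p-2/q} ‖b‖_{L^{p,q}(Q(z₀,R))}` (space norm `Lᵖ`, time norm `L^q`). -/
def Gfun (u : E3 → ℝ → E3) (p q : ℝ≥0∞) (z₀ : E3 × ℝ) (R : ℝ) : ℝ :=
  R ^ (1 - 3 / p.toReal - 2 / q.toReal) *
    (eLpNorm (fun t =>
        (eLpNorm (fun x => bnorm u x t) p (volume.restrict (Metric.ball z₀.1 R))).toReal)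
      q (volume.restrict (Ioo (z₀.2 - R ^ 2) z₀.2))).toReal

/-- `m_R = inf_{Q(R)} Γ`. -/
def mR (u : E3 → ℝ → E3) (R : ℝ) : ℝ :=
  sInf ((fun z : E3 × ℝ => Gam u z.1 z.2) '' Qyl (0, 0) R)

/-- `M_R = sup_{Q(R)} Γ`. -/
def MMR (u : E3 → ℝ → E3) (R : ℝ) : ℝ :=
  sSup ((fun z : E3 × ℝ => Gam u z.1 z.2) '' Qyl (0, 0) R)

/-- `J_R = M_R - m_R`. -/
def JR (u : E3 → ℝ → E3) (R : ℝ) : ℝ := MMR u R - mR u R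

/-- the normalized function `h`. -/
def hfun (u : E3 → ℝ → E3) (R : ℝ) (x : E3) (t : ℝ) : ℝ :=
  if -(mR u R) < MMR u R then 2 * (MMR u R - Gam u x t) / JR u R
  else 2 * (Gam u x t - mR u R) / JR u R

/-- oscillation of `Γ` over `Q(z₀,R)`. -/
def oscΓ (u : E3 → ℝ → E3) (z₀ : E3 × ℝ) (R : ℝ) : ℝ :=
  sSup ((fun z : E3 × ℝ => Gam u z.1 z.2) '' Qyl z₀ R) -
    sInf ((fun z : E3 × ℝ => Gam u z.1 z.2) '' Qyl z₀ R)

/-- Spatial coordinate directions of space-time. -/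
def spaceDir (i : Fin 3) : E3 × ℝ := (ee i, 0)

/-- Time direction of space-time. -/
def timeDir : E3 × ℝ := (0, 1)

instance : (volume : Measure (E3 × ℝ)).IsAddHaarMeasure :=
  inferInstanceAs ((volume : Measure E3).prod (volume : Measure ℝ)).IsAddHaarMeasure

/-- Smooth functions compactly supported in `U`. -/
structure IsTestOn (U : Set (E3 × ℝ)) (φ : E3 × ℝ → ℝ) : Prop where
  smooth : ContDiff ℝ (⊤ : ℕ∞) φ
  compact : HasCompactSupport φ
  supp : tsupport φ ⊆ U

/-- Integrable functions with vanishing integral. -/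
def HasZeroIntegral (f : E3 × ℝ → ℝ) : Prop := Integrable f ∧ ∫ z, f z = 0

namespace HasZeroIntegral

variable {f g : E3 × ℝ → ℝ}

theorem add (hf : HasZeroIntegral f) (hg : HasZeroIntegral g) :
    HasZeroIntegral fun z => f z + g z :=
  ⟨hf.1.add hg.1, by rw [integral_add hf.1 hg.1, hf.2, hg.2, add_zero]⟩

theorem const_mul (c : ℝ) (hf : HasZeroIntegral f) : HasZeroIntegral fun z => c * f z :=
  ⟨hf.1.const_mul c, by rw [integral_const_mul, hf.2, mul_zero]⟩

theorem sub (hf : HasZeroIntegral f) (hg : HasZeroIntegral g) :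
    HasZeroIntegral fun z => f z - g z :=
  ⟨hf.1.sub hg.1, by rw [integral_sub hf.1 hg.1, hf.2, hg.2, sub_zero]⟩

theorem sum {F : Fin 3 → E3 × ℝ → ℝ} (hF : ∀ i, HasZeroIntegral (F i)) :
    HasZeroIntegral fun z => ∑ i, F i z :=
  ⟨integrable_finsetSum _ fun i _ => (hF i).1, by
    rw [integral_finsetSum _ fun i _ => (hF i).1]
    exact Finset.sum_eq_zero fun i _ => (hF i).2⟩

end HasZeroIntegral

theorem contDiffOn_fderiv_apply {U : Set (E3 × ℝ)} (hU : IsOpen U) {g : E3 × ℝ → ℝ}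
    (hg : ContDiffOn ℝ (⊤ : ℕ∞) g U) (v : E3 × ℝ) :
    ContDiffOn ℝ (⊤ : ℕ∞) (fun z => fderiv ℝ g z v) U :=
  (hg.fderiv_of_isOpen hU (by simp)).clm_apply contDiffOn_const

theorem differentiableAt_of_contDiffOn {U : Set (E3 × ℝ)} (hU : IsOpen U) {g : E3 × ℝ → ℝ}
    (hg : ContDiffOn ℝ (⊤ : ℕ∞) g U) {z : E3 × ℝ} (hz : z ∈ U) : DifferentiableAt ℝ g z :=
  (hg.contDiffAt (hU.mem_nhds hz)).differentiableAt (by simp)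

namespace IsTestOn

variable {U : Set (E3 × ℝ)} {φ g : E3 × ℝ → ℝ}

theorem integrable (hφ : IsTestOn U φ) : Integrable φ :=
  hφ.smooth.continuous.integrable_of_hasCompactSupport hφ.compact

theorem fderiv_apply (hφ : IsTestOn U φ) (v : E3 × ℝ) : IsTestOn U fun z => fderiv ℝ φ z v :=
  ⟨(hφ.smooth.fderiv_right (by simp)).clm_apply contDiff_const,
    hφ.compact.fderiv_apply ℝ v, (tsupport_fderiv_apply_subset ℝ v).trans hφ.supp⟩

theorem mul_contDiffOn (hU : IsOpen U) (hφ : IsTestOn U φ) (hg : ContDiffOn ℝ (⊤ : ℕ∞) g U) :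
    IsTestOn U fun z => φ z * g z := by
  refine ⟨contDiff_iff_contDiffAt.2 fun z => ?_, hφ.compact.mul_right,
    (tsupport_mul_subset_left).trans hφ.supp⟩
  by_cases hz : z ∈ U
  · exact hφ.smooth.contDiffAt.mul (hg.contDiffAt (hU.mem_nhds hz))
  · have h0 : φ =ᶠ[nhds z] 0 := notMem_tsupport_iff_eventuallyEq.1 fun h => hz (hφ.supp h)
    refine (contDiffAt_const (c := (0 : ℝ))).congr_of_eventuallyEq ?_
    filter_upwards [h0] with y hy
    simp [hy]

theorem hasZeroIntegral_fderiv (hφ : IsTestOn U φ) (v : E3 × ℝ) :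
    HasZeroIntegral fun z => fderiv ℝ φ z v := by
  refine ⟨(hφ.fderiv_apply v).integrable, ?_⟩
  have h := integral_mul_fderiv_eq_neg_fderiv_mul_of_integrable (μ := volume) (𝕜 := ℝ)
    (f := fun _ => 1) (g := φ) (v := v) (by simp) (by simpa using (hφ.fderiv_apply v).integrable)
    (by simpa using hφ.integrable) (fun _ _ => by fun_prop)
    (fun z _ => hφ.smooth.differentiable (by simp) z)
  simpa using h

theorem apply_eq_zero (hφ : IsTestOn U φ) {z : E3 × ℝ} (hz : z ∉ U) : φ z = 0 :=
  image_eq_zero_of_notMem_tsupport fun h => hz (hφ.supp h)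

theorem fderiv_mul_apply (hU : IsOpen U) (hφ : IsTestOn U φ) (hg : ContDiffOn ℝ (⊤ : ℕ∞) g U)
    (v : E3 × ℝ) {z : E3 × ℝ} (hz : z ∈ U) :
    fderiv ℝ (fun y => φ y * g y) z v = φ z * fderiv ℝ g z v + g z * fderiv ℝ φ z v := by
  rw [fderiv_fun_mul (hφ.smooth.differentiable (by simp) z)
    (differentiableAt_of_contDiffOn hU hg hz)]
  simp

end IsTestOn

/-- The Navier–Stokes system written with space-time derivatives. -/
structure IsSpaceTimeNS (c : Fin 3 → E3 × ℝ → ℝ) (p : E3 × ℝ → ℝ) (U : Set (E3 × ℝ)) :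
    Prop where
  isOpen : IsOpen U
  smooth : ∀ j, ContDiffOn ℝ (⊤ : ℕ∞) (c j) U
  smooth_pressure : ContDiffOn ℝ (⊤ : ℕ∞) p U
  momentum : ∀ z ∈ U, ∀ j, fderiv ℝ (c j) z timeDir
    + ∑ i, c i z * fderiv ℝ (c j) z (spaceDir i)
    - ∑ i, fderiv ℝ (fun y => fderiv ℝ (c j) y (spaceDir i)) z (spaceDir i)
    + fderiv ℝ p z (spaceDir j) = 0
  divfree : ∀ z ∈ U, ∑ i, fderiv ℝ (c i) z (spaceDir i) = 0

theorem pd_slice {f : E3 × ℝ → ℝ} {x : E3} {t : ℝ} (hf : DifferentiableAt ℝ f (x, t))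
    (i : Fin 3) : pd (fun y => f (y, t)) i x = fderiv ℝ f (x, t) (spaceDir i) := by
  have h := hf.hasFDerivAt.comp x (hasFDerivAt_prodMk_left (𝕜 := ℝ) x t)
  have h' : fderiv ℝ (fun y => f (y, t)) x = _ := h.fderiv
  rw [pd, h']
  simp [spaceDir]

theorem deriv_slice {f : E3 × ℝ → ℝ} {x : E3} {t : ℝ} (hf : DifferentiableAt ℝ f (x, t)) :
    deriv (fun s => f (x, s)) t = fderiv ℝ f (x, t) timeDir := by
  have h := hf.hasFDerivAt.comp t (hasFDerivAt_prodMk_right (𝕜 := ℝ) x t)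
  have h' : fderiv ℝ (fun s => f (x, s)) t = _ := h.fderiv
  rw [← fderiv_apply_one_eq_deriv, h']
  simp [timeDir]

theorem IsNSQ1.isSpaceTimeNS {u : E3 → ℝ → E3} {P : E3 → ℝ → ℝ} {U : Set (E3 × ℝ)}
    (h : IsNSQ1 u P U) :
    IsSpaceTimeNS (fun j z => u z.1 z.2 j) (fun z => P z.1 z.2) U := by
  have hs : ∀ j : Fin 3, ContDiffOn ℝ (⊤ : ℕ∞) (fun z : E3 × ℝ => u z.1 z.2 j) U :=
    contDiffOn_euclidean.1 h.smooth_u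
  have hd := fun j {z} (hz : z ∈ U) => differentiableAt_of_contDiffOn h.open_U (hs j) hz
  refine ⟨h.open_U, hs, h.smooth_P, ?_, ?_⟩
  · rintro ⟨x, t⟩ hz j
    have e := h.momentum x t hz j
    have e1 := deriv_slice (hd j hz)
    have e2 := fun i => pd_slice (hd j hz) i
    have e3 := pd_slice (differentiableAt_of_contDiffOn h.open_U h.smooth_P hz) j
    have e4 : lap (fun y => u y t j) x = ∑ i, fderiv ℝ (fun y : E3 × ℝ =>
        fderiv ℝ (fun z : E3 × ℝ => u z.1 z.2 j) y (spaceDir i)) (x, t) (spaceDir i) := by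
      refine Finset.sum_congr rfl fun i _ => ?_
      rw [← pd_slice (differentiableAt_of_contDiffOn h.open_U
        (contDiffOn_fderiv_apply h.open_U (hs j) _) hz)]
      have hev : (fun y => pd (fun y => u y t j) i y) =ᶠ[nhds x] fun y =>
          fderiv ℝ (fun z : E3 × ℝ => u z.1 z.2 j) (y, t) (spaceDir i) := by
        have : ∀ᶠ y in nhds x, (y, t) ∈ U :=
          (Continuous.continuousAt (by fun_prop : Continuous fun y : E3 => (y, t))).preimage_mem_nhds
            (h.open_U.mem_nhds hz)
        filter_upwards [this] with y hy
        exact pd_slice (hd j hy) i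
      rw [pd, hev.fderiv_eq, ← pd]
    simp only at e1 e2 e3
    rw [e1, e4, e3] at e
    simp only [e2] at e
    exact e
  · rintro ⟨x, t⟩ hz
    have e := h.divfree x t hz
    have e2 := fun i => pd_slice (hd i hz) i
    simp only at e2
    simp only [e2] at e
    exact e

namespace IsSpaceTimeNS

variable {c : Fin 3 → E3 × ℝ → ℝ} {p : E3 × ℝ → ℝ} {U : Set (E3 × ℝ)}

/-- Weak form of the `j`-th momentum equation. -/
theorem weak_momentum (h : IsSpaceTimeNS c p U) (j : Fin 3) {w : E3 × ℝ → ℝ}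
    (hw : IsTestOn U w) :
    HasZeroIntegral fun z => c j z * fderiv ℝ w z timeDir
      + ∑ i, c i z * c j z * fderiv ℝ w z (spaceDir i)
      + ∑ i, c j z * fderiv ℝ (fun y => fderiv ℝ w y (spaceDir i)) z (spaceDir i)
      + p z * fderiv ℝ w z (spaceDir j) := by
  have hO := h.isOpen
  have hD := fun i => contDiffOn_fderiv_apply hO (h.smooth j) (spaceDir i)
  have H := ((((hw.mul_contDiffOn hO (h.smooth j)).hasZeroIntegral_fderiv timeDir).add
    (HasZeroIntegral.sum fun i => (hw.mul_contDiffOn hO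
      ((h.smooth i).mul (h.smooth j))).hasZeroIntegral_fderiv (spaceDir i))).add
    (HasZeroIntegral.sum fun i => (((hw.fderiv_apply (spaceDir i)).mul_contDiffOn hO
      (h.smooth j)).hasZeroIntegral_fderiv (spaceDir i)).sub
      ((hw.mul_contDiffOn hO (hD i)).hasZeroIntegral_fderiv (spaceDir i)))).add
    ((hw.mul_contDiffOn hO h.smooth_pressure).hasZeroIntegral_fderiv (spaceDir j))
  convert H using 2 with z
  by_cases hz : z ∈ U
  · have e := h.momentum z hz j
    have e' := h.divfree z hz
    have d := fun i => differentiableAt_of_contDiffOn hO (h.smooth i) hz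
    rw [hw.fderiv_mul_apply hO (h.smooth j) _ hz, hw.fderiv_mul_apply hO h.smooth_pressure _ hz]
    simp only [hw.fderiv_mul_apply hO (hD _) _ hz,
      (hw.fderiv_apply _).fderiv_mul_apply hO (h.smooth j) _ hz,
      hw.fderiv_mul_apply hO ((h.smooth _).mul (h.smooth j)) _ hz]
    simp only [fderiv_fun_mul (d _) (d j)]
    simp only [Fin.sum_univ_three, add_apply, smul_apply,
      smul_eq_mul] at e e' ⊢
    linear_combination (-w z) * e - w z * c j z * e'
  · rw [(hw.fderiv_apply _).apply_eq_zero hz]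
    simp only [(hw.fderiv_apply _).apply_eq_zero hz,
      ((hw.fderiv_apply _).fderiv_apply _).apply_eq_zero hz]
    simp only [((hw.mul_contDiffOn hO (h.smooth j)).fderiv_apply _).apply_eq_zero hz,
      ((hw.mul_contDiffOn hO h.smooth_pressure).fderiv_apply _).apply_eq_zero hz,
      ((hw.mul_contDiffOn hO (hD _)).fderiv_apply _).apply_eq_zero hz,
      (((hw.fderiv_apply _).mul_contDiffOn hO (h.smooth j)).fderiv_apply _).apply_eq_zero hz,
      ((hw.mul_contDiffOn hO ((h.smooth _).mul (h.smooth j))).fderiv_apply _).apply_eq_zero hz]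
    simp

/-- The drift–diffusion operator `∂ₜ + u · ∇ + Δ` integrates to zero on test functions. -/
theorem hasZeroIntegral_transport (h : IsSpaceTimeNS c p U) {w : E3 × ℝ → ℝ}
    (hw : IsTestOn U w) :
    HasZeroIntegral fun z => fderiv ℝ w z timeDir
      + ∑ i, c i z * fderiv ℝ w z (spaceDir i)
      + ∑ i, fderiv ℝ (fun y => fderiv ℝ w y (spaceDir i)) z (spaceDir i) := by
  have hO := h.isOpen
  have H := ((hw.hasZeroIntegral_fderiv timeDir).add
    (HasZeroIntegral.sum fun i => (hw.mul_contDiffOn hO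
      (h.smooth i)).hasZeroIntegral_fderiv (spaceDir i))).add
    (HasZeroIntegral.sum fun i => (hw.fderiv_apply (spaceDir i)).hasZeroIntegral_fderiv
      (spaceDir i))
  convert H using 2 with z
  by_cases hz : z ∈ U
  · have e' := h.divfree z hz
    simp only [hw.fderiv_mul_apply hO (h.smooth _) _ hz]
    simp only [Fin.sum_univ_three] at e' ⊢
    linear_combination (-w z) * e'
  · rw [(hw.fderiv_apply _).apply_eq_zero hz]
    simp only [(hw.fderiv_apply _).apply_eq_zero hz,
      ((hw.mul_contDiffOn hO (h.smooth _)).fderiv_apply _).apply_eq_zero hz]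
    simp

end IsSpaceTimeNS

theorem fderiv_coord_apply (k : Fin 3) (v z : E3 × ℝ) :
    fderiv ℝ (fun y : E3 × ℝ => y.1 k) z v = v.1 k := by
  have h := ((EuclideanSpace.proj k : E3 →L[ℝ] ℝ).comp
    (ContinuousLinearMap.fst ℝ E3 ℝ)).hasFDerivAt (x := z)
  have h' : fderiv ℝ (fun y : E3 × ℝ => y.1 k) z = _ := h.fderiv
  rw [h']
  simp

theorem contDiff_coord (k : Fin 3) : ContDiff ℝ (⊤ : ℕ∞) fun y : E3 × ℝ => y.1 k :=
  ((EuclideanSpace.proj k : E3 →L[ℝ] ℝ).comp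
    (ContinuousLinearMap.fst ℝ E3 ℝ)).contDiff

theorem fderiv_mul_coord_apply {φ : E3 × ℝ → ℝ} (hφ : Differentiable ℝ φ) (k : Fin 3)
    (v z : E3 × ℝ) :
    fderiv ℝ (fun y => φ y * y.1 k) z v = φ z * v.1 k + z.1 k * fderiv ℝ φ z v := by
  rw [fderiv_fun_mul (hφ z) ((contDiff_coord k).differentiable (by simp) z)]
  simp [fderiv_coord_apply]

theorem fderiv_fderiv_mul_coord_apply {φ : E3 × ℝ → ℝ} (hφ : ContDiff ℝ (⊤ : ℕ∞) φ) (k : Fin 3)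
    (v z : E3 × ℝ) :
    fderiv ℝ (fun y => fderiv ℝ (fun y => φ y * y.1 k) y v) z v
      = 2 * v.1 k * fderiv ℝ φ z v + z.1 k * fderiv ℝ (fun y => fderiv ℝ φ y v) z v := by
  have h1 : Differentiable ℝ φ := hφ.differentiable (by simp)
  have h2 : Differentiable ℝ fun y => fderiv ℝ φ y v :=
    ((hφ.fderiv_right (m := (⊤ : ℕ∞)) (by simp)).clm_apply contDiff_const).differentiable (by simp)
  have h3 : (fun y => fderiv ℝ (fun y => φ y * y.1 k) y v)
      = fun y => φ y * v.1 k + fderiv ℝ φ y v * y.1 k := by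
    funext y
    rw [fderiv_mul_coord_apply h1]
    ring
  have h4 : DifferentiableAt ℝ (fun y => fderiv ℝ φ y v * y.1 k) z :=
    (h2 z).mul ((contDiff_coord k).differentiable (by simp) z)
  rw [h3, fderiv_fun_add ((h1 z).mul_const _) h4, fderiv_mul_const (h1 z), add_apply,
    fderiv_mul_coord_apply h2]
  simp only [smul_apply, smul_eq_mul]
  ring

/-- The operator `∂ₜ + u · ∇ + Δ` acting on test functions. -/
def transportOp (c : Fin 3 → E3 × ℝ → ℝ) (φ : E3 × ℝ → ℝ) (z : E3 × ℝ) : ℝ :=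
  fderiv ℝ φ z timeDir + ∑ i, c i z * fderiv ℝ φ z (spaceDir i)
    + ∑ i, fderiv ℝ (fun y => fderiv ℝ φ y (spaceDir i)) z (spaceDir i)

namespace IsSpaceTimeNS

variable {c : Fin 3 → E3 × ℝ → ℝ} {p : E3 × ℝ → ℝ} {U : Set (E3 × ℝ)}

/-- Weak form of the swirl equation, tested with functions whose horizontal gradient is radial. -/
theorem weak_swirl (h : IsSpaceTimeNS c p U) {φ ψ : E3 × ℝ → ℝ} (hφ : IsTestOn U φ)
    (hψ : ∀ z (i : Fin 3), fderiv ℝ φ z (spaceDir i) = z.1 i * ψ z) :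
    HasZeroIntegral fun z => (z.1 0 * c 1 z - z.1 1 * c 0 z) *
      (transportOp c φ z + 2 * ψ z) := by
  have H := (h.weak_momentum 1 (hφ.mul_contDiffOn h.isOpen (contDiff_coord 0).contDiffOn)).sub
    (h.weak_momentum 0 (hφ.mul_contDiffOn h.isOpen (contDiff_coord 1).contDiffOn))
  convert H using 2 with z
  simp only [fderiv_fderiv_mul_coord_apply hφ.smooth]
  simp only [fderiv_mul_coord_apply (hφ.smooth.differentiable (by simp)), transportOp,
    Fin.sum_univ_three]
  have e : ∀ i j : Fin 3, (spaceDir i).1 j = if j = i then 1 else 0 := fun i j => by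
    simp [spaceDir, ee]
  have e' : ∀ j : Fin 3, timeDir.1 j = 0 := fun j => by simp [timeDir]
  simp only [e, e', hψ z]
  simp
  ring

/-- Weak form of the equation for an affine function of the swirl. -/
theorem weak_affine_swirl (h : IsSpaceTimeNS c p U) {φ ψ : E3 × ℝ → ℝ} (hφ : IsTestOn U φ)
    (hψ : ∀ z (i : Fin 3), fderiv ℝ φ z (spaceDir i) = z.1 i * ψ z) (α β : ℝ) :
    HasZeroIntegral fun z => (α + β * (z.1 0 * c 1 z - z.1 1 * c 0 z)) *
      (transportOp c φ z + 2 * ψ z) - α * (2 * ψ z) := by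
  have H := ((h.hasZeroIntegral_transport hφ).const_mul α).add
    ((h.weak_swirl hφ hψ).const_mul β)
  convert H using 2 with z
  rw [transportOp]
  ring

end IsSpaceTimeNS

/-- Radial and temporal cutoff profiles, with a common bound `C` on the derivatives used. -/
structure IsCutoffPair (η θ : ℝ → ℝ) (C : ℝ) : Prop where
  smooth_radial : ContDiff ℝ (⊤ : ℕ∞) η
  smooth_time : ContDiff ℝ (⊤ : ℕ∞) θ
  radial_zero : ∀ s, 1 / 4 ≤ s → η s = 0 ∧ deriv η s = 0 ∧ deriv (deriv η) s = 0
  time_zero : ∀ τ, τ ∉ Ioo (-1 : ℝ) (-1 / 4) → θ τ = 0 ∧ deriv θ τ = 0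
  radial_bound : ∀ s, 0 ≤ s → |η s| ≤ C ∧ |deriv η s| ≤ C ∧ |deriv (deriv η) s| ≤ C
  time_bound : ∀ τ, |θ τ| ≤ C ∧ |deriv θ τ| ≤ C
  radial_integral : ∫ x : E3, deriv η (‖x‖ ^ 2) < 0
  time_integral : 0 < ∫ τ, θ τ

theorem exists_bound_of_eq_zero {f : ℝ → ℝ} (hf : Continuous f) {a b : ℝ}
    (h0 : ∀ s, b < s → f s = 0) : ∃ C, ∀ s, a ≤ s → |f s| ≤ C := by
  obtain ⟨C, hC⟩ := (isCompact_Icc (a := a) (b := b)).exists_bound_of_continuousOn hf.continuousOn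
  refine ⟨max C 0, fun s hs => ?_⟩
  by_cases h : s ≤ b
  · exact (hC s ⟨hs, h⟩).trans (le_max_left _ _)
  · simp [h0 s (not_le.1 h)]

theorem exists_isCutoffPair : ∃ η θ : ℝ → ℝ, ∃ C : ℝ, IsCutoffPair η θ C := by
  set η : ℝ → ℝ := fun s => expNegInvGlue (1 / 8 - s) with hη
  set θ : ℝ → ℝ := fun τ => expNegInvGlue (τ + 7 / 8) * expNegInvGlue (-3 / 8 - τ) with hθ
  have hηs : ContDiff ℝ (⊤ : ℕ∞) η :=
    expNegInvGlue.contDiff.comp (contDiff_const.sub contDiff_id)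
  have hθs : ContDiff ℝ (⊤ : ℕ∞) θ :=
    (expNegInvGlue.contDiff.comp (contDiff_id.add contDiff_const)).mul
      (expNegInvGlue.contDiff.comp (contDiff_const.sub contDiff_id))
  have hη' : ContDiff ℝ (⊤ : ℕ∞) (deriv η) := hηs.deriv'
  have hη'' : ContDiff ℝ (⊤ : ℕ∞) (deriv (deriv η)) := hη'.deriv'
  have hθ' : ContDiff ℝ (⊤ : ℕ∞) (deriv θ) := hθs.deriv'
  have zη : ∀ s, 1 / 8 < s → η s = 0 := fun s hs =>
    expNegInvGlue.zero_of_nonpos (by linarith)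
  have zd : ∀ f : ℝ → ℝ, (∀ s, 1 / 8 < s → f s = 0) → ∀ s, 1 / 8 < s → deriv f s = 0 := by
    intro f hf s hs
    have : f =ᶠ[nhds s] fun _ => 0 := by
      filter_upwards [lt_mem_nhds hs] with y hy using hf y hy
    rw [this.deriv_eq]
    simp
  have zη' := zd η zη
  have zη'' := zd _ zη'
  have zθ : ∀ τ, τ ∉ Icc (-7 / 8 : ℝ) (-3 / 8) → θ τ = 0 := by
    intro τ hτ
    by_cases h1 : -7 / 8 ≤ τ
    · have : expNegInvGlue (-3 / 8 - τ) = 0 := expNegInvGlue.zero_of_nonpos (by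
        by_contra h2
        exact hτ ⟨h1, by linarith⟩)
      simp [hθ, this]
    · have : expNegInvGlue (τ + 7 / 8) = 0 := expNegInvGlue.zero_of_nonpos (by linarith)
      simp [hθ, this]
  have zθ' : ∀ τ, τ ∉ Icc (-7 / 8 : ℝ) (-3 / 8) → deriv θ τ = 0 := by
    intro τ hτ
    have : θ =ᶠ[nhds τ] fun _ => 0 := by
      filter_upwards [isClosed_Icc.isOpen_compl.mem_nhds hτ] with y hy using zθ y hy
    rw [this.deriv_eq]
    simp
  obtain ⟨C0, b0⟩ := exists_bound_of_eq_zero (a := 0) hηs.continuous zη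
  obtain ⟨C1, b1⟩ := exists_bound_of_eq_zero (a := 0) hη'.continuous zη'
  obtain ⟨C2, b2⟩ := exists_bound_of_eq_zero (a := 0) hη''.continuous zη''
  obtain ⟨C3, b3⟩ := hθs.continuous.bounded_above_of_compact_support
    (HasCompactSupport.intro isCompact_Icc zθ)
  obtain ⟨C4, b4⟩ := hθ'.continuous.bounded_above_of_compact_support
    (HasCompactSupport.intro isCompact_Icc zθ')
  have hanti : Antitone η := fun a b hab => expNegInvGlue.monotone (by linarith)
  refine ⟨η, θ, max C0 (max C1 (max C2 (max C3 C4))), hηs, hθs, ?_, ?_, ?_, ?_, ?_, ?_⟩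
  · intro s hs
    have : 1 / 8 < s := by linarith
    exact ⟨zη s this, zη' s this, zη'' s this⟩
  · intro τ hτ
    have : τ ∉ Icc (-7 / 8 : ℝ) (-3 / 8) := fun h => hτ ⟨by linarith [h.1], by linarith [h.2]⟩
    exact ⟨zθ τ this, zθ' τ this⟩
  · intro s hs
    have h0 := b0 s hs
    have h1 := b1 s hs
    have h2 := b2 s hs
    simp only [le_max_iff]
    tauto
  · intro τ
    have h3 := b3 τ
    have h4 := b4 τ
    rw [Real.norm_eq_abs] at h3 h4
    simp only [le_max_iff]
    tauto
  · obtain ⟨s, hs, hs'⟩ := exists_deriv_eq_slope η (a := 0) (b := 1 / 4) (by norm_num)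
      hηs.continuous.continuousOn (hηs.differentiable (by simp)).differentiableOn
    have hs0 : deriv η s < 0 := by
      have h1 : 0 < η 0 := expNegInvGlue.pos_of_pos (by norm_num)
      rw [hs', zη (1 / 4) (by norm_num)]
      exact div_neg_of_neg_of_pos (by linarith) (by norm_num)
    have hc : Continuous fun x : E3 => -deriv η (‖x‖ ^ 2) :=
      (hη'.continuous.comp (by fun_prop)).neg
    have hcs : HasCompactSupport fun x : E3 => -deriv η (‖x‖ ^ 2) :=
      HasCompactSupport.intro (isCompact_closedBall (0 : E3) 1) fun x hx => by
        rw [mem_closedBall_zero_iff, not_le] at hx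
        rw [zη' _ (by nlinarith), neg_zero]
    have hpos : 0 < ∫ x : E3, -deriv η (‖x‖ ^ 2) := by
      refine hc.integral_pos_of_hasCompactSupport_nonneg_nonzero hcs
        (fun x => neg_nonneg.2 hanti.deriv_nonpos) (x := Real.sqrt s • ee 0) ?_
      have : ‖Real.sqrt s • ee 0‖ ^ 2 = s := by
        simp [norm_smul, ee, Real.sq_sqrt hs.1.le]
      rw [this]
      exact neg_ne_zero.2 hs0.ne
    rw [integral_neg] at hpos
    linarith
  · refine hθs.continuous.integral_pos_of_hasCompactSupport_nonneg_nonzero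
      (HasCompactSupport.intro isCompact_Icc zθ)
      (fun τ => mul_nonneg (expNegInvGlue.nonneg _) (expNegInvGlue.nonneg _)) (x := -5 / 8) ?_
    exact ne_of_gt (mul_pos (expNegInvGlue.pos_of_pos (by norm_num))
      (expNegInvGlue.pos_of_pos (by norm_num)))

/-- Product cutoff at parabolic scale `R`. -/
def cutoff (f g : ℝ → ℝ) (R : ℝ) (z : E3 × ℝ) : ℝ := f (‖z.1‖ ^ 2 / R ^ 2) * g (z.2 / R ^ 2)

theorem fderiv_cutoff {f g : ℝ → ℝ} (hf : Differentiable ℝ f) (hg : Differentiable ℝ g)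
    (R : ℝ) (z v : E3 × ℝ) :
    fderiv ℝ (cutoff f g R) z v = 2 / R ^ 2 * inner ℝ z.1 v.1 * cutoff (deriv f) g R z
      + v.2 / R ^ 2 * cutoff f (deriv g) R z := by
  have h1 : HasFDerivAt (fun z : E3 × ℝ => ‖z.1‖ ^ 2 / R ^ 2) _ z :=
    ((hasFDerivAt_fst (𝕜 := ℝ) (p := z)).norm_sq).mul_const (R ^ 2)⁻¹
  have h2 : HasFDerivAt (fun z : E3 × ℝ => z.2 / R ^ 2) _ z :=
    (hasFDerivAt_snd (𝕜 := ℝ) (p := z)).mul_const (R ^ 2)⁻¹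
  have h := ((hf _).hasDerivAt.comp_hasFDerivAt z h1).mul ((hg _).hasDerivAt.comp_hasFDerivAt z h2)
  have h' : fderiv ℝ (cutoff f g R) z = _ := h.fderiv
  rw [h']
  simp [cutoff]
  ring

theorem fderiv_cutoff_spaceDir {f g : ℝ → ℝ} (hf : Differentiable ℝ f) (hg : Differentiable ℝ g)
    (R : ℝ) (z : E3 × ℝ) (i : Fin 3) :
    fderiv ℝ (cutoff f g R) z (spaceDir i)
      = z.1 i * (2 / R ^ 2 * cutoff (deriv f) g R z) := by
  rw [fderiv_cutoff hf hg]
  simp [spaceDir, ee, EuclideanSpace.inner_single_right]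
  ring

theorem fderiv_cutoff_timeDir {f g : ℝ → ℝ} (hf : Differentiable ℝ f) (hg : Differentiable ℝ g)
    (R : ℝ) (z : E3 × ℝ) :
    fderiv ℝ (cutoff f g R) z timeDir = (R ^ 2)⁻¹ * cutoff f (deriv g) R z := by
  rw [fderiv_cutoff hf hg]
  simp [timeDir]

theorem contDiff_cutoff {f g : ℝ → ℝ} (hf : ContDiff ℝ (⊤ : ℕ∞) f) (hg : ContDiff ℝ (⊤ : ℕ∞) g)
    (R : ℝ) : ContDiff ℝ (⊤ : ℕ∞) (cutoff f g R) :=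
  (hf.comp ((contDiff_fst.norm_sq ℝ).div_const _)).mul (hg.comp (contDiff_snd.div_const _))

/-- The cylinder carrying the cutoff functions of scale `R`. -/
def cutoffCylinder (R : ℝ) : Set (E3 × ℝ) :=
  Metric.ball 0 (R / 2) ×ˢ Ioo (-R ^ 2) (-R ^ 2 / 4)

theorem cutoff_eq_zero {f g : ℝ → ℝ} {R : ℝ} (hR : 0 < R) (hf : ∀ s, 1 / 4 ≤ s → f s = 0)
    (hg : ∀ τ, τ ∉ Ioo (-1 : ℝ) (-1 / 4) → g τ = 0) {z : E3 × ℝ} (hz : z ∉ cutoffCylinder R) :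
    cutoff f g R z = 0 := by
  have hR2 : 0 < R ^ 2 := by positivity
  by_cases h : z.1 ∈ Metric.ball (0 : E3) (R / 2)
  · have : z.2 / R ^ 2 ∉ Ioo (-1 : ℝ) (-1 / 4) := by
      rintro ⟨h1, h2⟩
      rw [lt_div_iff₀ hR2] at h1
      rw [div_lt_iff₀ hR2] at h2
      exact hz ⟨h, by linarith, by linarith⟩
    rw [cutoff, hg _ this, mul_zero]
  · rw [mem_ball_zero_iff, not_lt] at h
    have : 1 / 4 ≤ ‖z.1‖ ^ 2 / R ^ 2 := by
      rw [le_div_iff₀ hR2]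
      nlinarith
    rw [cutoff, hf _ this, zero_mul]

theorem cutoffCylinder_subset {R : ℝ} (hR : 0 < R) :
    cutoffCylinder R ⊆ Qyl (0, 0) R := by
  rintro z ⟨h1, h2, h3⟩
  rw [mem_ball_zero_iff] at h1
  refine ⟨mem_ball_zero_iff.2 (by linarith), by simpa using h2, ?_⟩
  have : 0 < R ^ 2 := by positivity
  simp only
  linarith

theorem closure_Qyl_zero {R : ℝ} (hR : 0 < R) :
    closure (Qyl (0, 0) R) = Metric.closedBall (0 : E3) R ×ˢ Icc (-R ^ 2) 0 := by
  have : (0 : ℝ) - R ^ 2 ≠ 0 := by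
    have : 0 < R ^ 2 := by positivity
    linarith
  simp only [Qyl]
  rw [closure_prod_eq, closure_ball _ hR.ne', closure_Ioo this, zero_sub]

theorem isCompact_closure_Qyl_zero {R : ℝ} (hR : 0 < R) :
    IsCompact (closure (Qyl (0, 0) R) : Set (E3 × ℝ)) := by
  rw [closure_Qyl_zero hR]
  exact (isCompact_closedBall _ _).prod isCompact_Icc

theorem isTestOn_cutoff {f g : ℝ → ℝ} (hfs : ContDiff ℝ (⊤ : ℕ∞) f)
    (hgs : ContDiff ℝ (⊤ : ℕ∞) g) {R : ℝ} (hR : 0 < R) (hf : ∀ s, 1 / 4 ≤ s → f s = 0)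
    (hg : ∀ τ, τ ∉ Ioo (-1 : ℝ) (-1 / 4) → g τ = 0) {U : Set (E3 × ℝ)}
    (hU : closure (Qyl (0, 0) R) ⊆ U) : IsTestOn U (cutoff f g R) := by
  have h : Function.support (cutoff f g R) ⊆ Qyl (0, 0) R := fun z hz =>
    cutoffCylinder_subset hR (by
      by_contra h
      exact hz (cutoff_eq_zero hR hf hg h))
  refine ⟨contDiff_cutoff hfs hgs R, ?_, (closure_mono h).trans hU⟩
  exact (isCompact_closure_Qyl_zero hR).of_isClosed_subset isClosed_closure (closure_mono h)

theorem integral_cutoff (f g : ℝ → ℝ) {R : ℝ} (hR : 0 < R) :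
    ∫ z, cutoff f g R z = R ^ 5 * ((∫ x : E3, f (‖x‖ ^ 2)) * ∫ τ, g τ) := by
  have h1 : ∫ x : E3, f (‖x‖ ^ 2 / R ^ 2) = R ^ 3 * ∫ x : E3, f (‖x‖ ^ 2) := by
    have h := Measure.integral_comp_inv_smul_of_nonneg volume (fun x : E3 => f (‖x‖ ^ 2)) hR.le
    rw [finrank_euclideanSpace_fin, smul_eq_mul] at h
    rw [← h]
    refine integral_congr_ae (.of_forall fun x => ?_)
    simp only [norm_smul, norm_inv, Real.norm_eq_abs, abs_of_pos hR]
    congr 1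
    field_simp
  have h2 : ∫ t, g (t / R ^ 2) = R ^ 2 * ∫ τ, g τ := by
    rw [Measure.integral_comp_div, abs_of_pos (by positivity), smul_eq_mul]
  have h3 := integral_prod_mul (μ := (volume : Measure E3)) (ν := (volume : Measure ℝ))
    (fun x => f (‖x‖ ^ 2 / R ^ 2)) (fun t => g (t / R ^ 2))
  rw [h1, h2] at h3
  rw [Measure.volume_eq_prod]
  simp only [cutoff]
  rw [h3]
  ring

theorem transportOp_cutoff {η θ : ℝ → ℝ} (hη : ContDiff ℝ (⊤ : ℕ∞) η)
    (hθ : ContDiff ℝ (⊤ : ℕ∞) θ) (c : Fin 3 → E3 × ℝ → ℝ) (R : ℝ) (z : E3 × ℝ) :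
    transportOp c (cutoff η θ R) z + 2 * (2 / R ^ 2 * cutoff (deriv η) θ R z)
      = (R ^ 2)⁻¹ * cutoff η (deriv θ) R z
        + 2 / R ^ 2 * cutoff (deriv η) θ R z * (∑ i, c i z * z.1 i + 5)
        + 4 / R ^ 4 * ‖z.1‖ ^ 2 * cutoff (deriv (deriv η)) θ R z := by
  have dη := hη.differentiable (by simp)
  have dθ := hθ.differentiable (by simp)
  have dη' : Differentiable ℝ (deriv η) :=
    (hη.deriv' : ContDiff ℝ (⊤ : ℕ∞) (deriv η)).differentiable (by simp)
  have dc : Differentiable ℝ (cutoff (deriv η) θ R) :=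
    (contDiff_cutoff hη.deriv' hθ R).differentiable (by simp)
  have h2 : ∀ i, fderiv ℝ (fun y => fderiv ℝ (cutoff η θ R) y (spaceDir i)) z (spaceDir i)
      = 2 / R ^ 2 * cutoff (deriv η) θ R z
        + z.1 i ^ 2 * (4 / R ^ 4 * cutoff (deriv (deriv η)) θ R z) := by
    intro i
    have e : (fun y => fderiv ℝ (cutoff η θ R) y (spaceDir i))
        = fun y => (2 / R ^ 2 * cutoff (deriv η) θ R y) * y.1 i := by
      funext y
      rw [fderiv_cutoff_spaceDir dη dθ]
      ring
    rw [e, fderiv_mul_coord_apply (dc.const_mul _), fderiv_const_mul (dc z), smul_apply,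
      fderiv_cutoff_spaceDir dη' dθ]
    simp [spaceDir, ee]
    ring
  simp only [transportOp, h2]
  simp only [fderiv_cutoff_timeDir dη dθ, fderiv_cutoff_spaceDir dη dθ, Fin.sum_univ_three,
    EuclideanSpace.norm_sq_eq, Real.norm_eq_abs, sq_abs]
  ring

theorem abs_transportOp_cutoff_le {η θ : ℝ → ℝ} {C : ℝ} (H : IsCutoffPair η θ C)
    (c : Fin 3 → E3 × ℝ → ℝ) {R : ℝ} (hR : 0 < R) {z : E3 × ℝ} (hz : z ∈ cutoffCylinder R)
    {a : ℝ} (ha : |∑ i, c i z * z.1 i| ≤ a * ‖z.1‖) :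
    |transportOp c (cutoff η θ R) z + 2 * (2 / R ^ 2 * cutoff (deriv η) θ R z)|
      ≤ C ^ 2 * (12 / R ^ 2 + |a| / R) := by
  have hx : ‖z.1‖ < R / 2 := mem_ball_zero_iff.1 hz.1
  obtain ⟨b0, b1, b2⟩ := H.radial_bound (‖z.1‖ ^ 2 / R ^ 2) (by positivity)
  obtain ⟨d0, d1⟩ := H.time_bound (z.2 / R ^ 2)
  have hC : 0 ≤ C := (abs_nonneg _).trans b0
  have cut : ∀ f g : ℝ → ℝ, |f (‖z.1‖ ^ 2 / R ^ 2)| ≤ C → |g (z.2 / R ^ 2)| ≤ C →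
      |cutoff f g R z| ≤ C ^ 2 := fun f g h1 h2 => by
    rw [cutoff, abs_mul, pow_two C]
    exact mul_le_mul h1 h2 (abs_nonneg _) hC
  have e1 := cut _ _ b0 d1
  have e2 := cut _ _ b1 d0
  have e3 := cut _ _ b2 d0
  rw [transportOp_cutoff H.smooth_radial H.smooth_time]
  have ha' : |∑ i, c i z * z.1 i + 5| ≤ |a| * (R / 2) + 5 := by
    have h1 : |∑ i, c i z * z.1 i| ≤ |a| * (R / 2) :=
      ha.trans (mul_le_mul (le_abs_self a) hx.le (norm_nonneg _) (abs_nonneg _))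
    have h2 := abs_add_le (∑ i, c i z * z.1 i) 5
    rw [abs_of_pos (by positivity : (0 : ℝ) < 5)] at h2
    linarith
  have t1 : |(R ^ 2)⁻¹ * cutoff η (deriv θ) R z| ≤ (R ^ 2)⁻¹ * C ^ 2 := by
    rw [abs_mul, abs_of_pos (by positivity)]
    gcongr
  have t2 : |2 / R ^ 2 * cutoff (deriv η) θ R z * (∑ i, c i z * z.1 i + 5)|
      ≤ 2 / R ^ 2 * C ^ 2 * (|a| * (R / 2) + 5) := by
    rw [abs_mul, abs_mul, abs_of_pos (by positivity : 0 < 2 / R ^ 2)]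
    gcongr
  have t3 : |4 / R ^ 4 * ‖z.1‖ ^ 2 * cutoff (deriv (deriv η)) θ R z|
      ≤ 4 / R ^ 4 * (R / 2) ^ 2 * C ^ 2 := by
    rw [abs_mul, abs_of_nonneg (by positivity : 0 ≤ 4 / R ^ 4 * ‖z.1‖ ^ 2)]
    gcongr
  refine (abs_add_three _ _ _).trans ((add_le_add (add_le_add t1 t2) t3).trans (le_of_eq ?_))
  field_simp
  ring

theorem hfun_eq_affine {u : E3 → ℝ → E3} {R : ℝ} (hJ : 0 < JR u R) :
    ∃ α β : ℝ, 1 ≤ α ∧ ∀ x t, hfun u R x t = α + β * Gam u x t := by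
  by_cases h : -(mR u R) < MMR u R
  · refine ⟨2 * MMR u R / JR u R, -2 / JR u R, ?_, fun x t => ?_⟩
    · rw [le_div_iff₀ hJ, JR]
      linarith
    · rw [hfun, if_pos h]
      ring
  · refine ⟨-2 * mR u R / JR u R, 2 / JR u R, ?_, fun x t => ?_⟩
    · rw [le_div_iff₀ hJ, JR]
      linarith
    · rw [hfun, if_neg h]
      ring

theorem hfun_mem_Icc {u : E3 → ℝ → E3} {R C : ℝ} (hJ : 0 < JR u R)
    (hC : ∀ z ∈ Qyl (0, 0) R, |Gam u z.1 z.2| ≤ C) {z : E3 × ℝ} (hz : z ∈ Qyl (0, 0) R) :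
    hfun u R z.1 z.2 ∈ Icc (0 : ℝ) 2 := by
  have hM : Gam u z.1 z.2 ≤ MMR u R := le_csSup
    ⟨C, by rintro _ ⟨y, hy, rfl⟩; exact (abs_le.1 (hC y hy)).2⟩ ⟨z, hz, rfl⟩
  have hm : mR u R ≤ Gam u z.1 z.2 := csInf_le
    ⟨-C, by rintro _ ⟨y, hy, rfl⟩; exact (abs_le.1 (hC y hy)).1⟩ ⟨z, hz, rfl⟩
  rw [hfun]
  split_ifs
  · refine ⟨div_nonneg (by linarith) hJ.le, ?_⟩
    rw [div_le_iff₀ hJ, JR]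
    linarith
  · refine ⟨div_nonneg (by linarith) hJ.le, ?_⟩
    rw [div_le_iff₀ hJ, JR]
    linarith

theorem AA_nonneg (u : E3 → ℝ → E3) {R : ℝ} (hR : 0 < R) : 0 ≤ AA u (0, 0) R :=
  Real.iSup_nonneg fun _ => Real.iSup_nonneg fun _ => by positivity

theorem le_AA {u : E3 → ℝ → E3} {R C : ℝ} (hR : 0 < R)
    (hC : ∀ z ∈ Qyl (0, 0) R, ‖u z.1 z.2‖ ≤ C) {t : ℝ} (ht : t ∈ Ioo (-R ^ 2) 0) :
    R⁻¹ * ∫ x in Metric.ball (0 : E3) R, ‖u x t‖ ^ 2 ≤ AA u (0, 0) R := by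
  have ht' : t ∈ Ioo ((0 : ℝ) - R ^ 2) 0 := by simpa using ht
  have hb : BddAbove (range fun t => ⨆ _ : t ∈ Ioo ((0 : ℝ) - R ^ 2) 0,
      R⁻¹ * ∫ x in Metric.ball (0 : E3) R, ‖u x t‖ ^ 2) := by
    refine ⟨R⁻¹ * (C ^ 2 * volume.real (Metric.ball (0 : E3) R)), ?_⟩
    rintro _ ⟨s, rfl⟩
    by_cases hs : s ∈ Ioo ((0 : ℝ) - R ^ 2) 0
    · simp only [ciSup_pos hs]
      gcongr
      refine (Real.le_norm_self _).trans (norm_setIntegral_le_of_norm_le_const measure_ball_lt_top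
        fun x hx => ?_)
      rw [norm_pow, norm_norm]
      gcongr
      exact hC (x, s) ⟨hx, hs⟩
    · have : IsEmpty (s ∈ Ioo ((0 : ℝ) - R ^ 2) 0) := ⟨hs⟩
      simp only [Real.iSup_of_isEmpty]
      positivity
  refine le_trans (le_of_eq ?_) (le_ciSup hb t)
  simp only [ciSup_pos ht']

theorem setIntegral_prod_symm_volume {s : Set E3} {T : Set ℝ} {f : E3 × ℝ → ℝ}
    (hf : IntegrableOn f (s ×ˢ T)) :
    ∫ z in s ×ˢ T, f z = ∫ t in T, ∫ x in s, f (x, t) := by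
  rw [IntegrableOn, Measure.volume_eq_prod, ← Measure.prod_restrict] at hf
  rw [Measure.volume_eq_prod, ← Measure.prod_restrict, integral_prod_symm _ hf]

theorem setIntegral_norm_sq_le {u : E3 → ℝ → E3} {R : ℝ} (hR : 0 < R)
    (hu : ContinuousOn (fun z : E3 × ℝ => u z.1 z.2) (closure (Qyl (0, 0) R))) :
    ∫ z in cutoffCylinder R, ‖u z.1 z.2‖ ^ 2 ≤ R ^ 3 * AA u (0, 0) R := by
  obtain ⟨C, hC⟩ := (isCompact_closure_Qyl_zero hR).exists_bound_of_continuousOn hu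
  have hR2 : 0 < R ^ 2 := by positivity
  have hint : IntegrableOn (fun z : E3 × ℝ => ‖u z.1 z.2‖ ^ 2) (cutoffCylinder R) :=
    ((hu.norm.pow 2).integrableOn_compact (isCompact_closure_Qyl_zero hR)).mono_set
      ((cutoffCylinder_subset hR).trans subset_closure)
  rw [cutoffCylinder, setIntegral_prod_symm_volume hint]
  have hbound : ∀ t ∈ Ioo (-R ^ 2) (-R ^ 2 / 4),
      ‖∫ x in Metric.ball (0 : E3) (R / 2), ‖u x t‖ ^ 2‖ ≤ R * AA u (0, 0) R := by
    intro t ht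
    have ht' : t ∈ Ioo (-R ^ 2) 0 := ⟨ht.1, by linarith [ht.2]⟩
    have h := le_AA hR (fun z hz => hC z (subset_closure hz)) ht'
    rw [inv_mul_le_iff₀ hR] at h
    rw [Real.norm_eq_abs, abs_of_nonneg (by positivity)]
    refine le_trans (setIntegral_mono_set ?_ (.of_forall fun x => by positivity)
      (Metric.ball_subset_ball (by linarith)).eventuallyLE) h
    have hcont : ContinuousOn (fun x => ‖u x t‖ ^ 2) (Metric.closedBall (0 : E3) R) := by
      refine ((hu.comp (f := fun x : E3 => (x, t)) (by fun_prop) fun x hx => ?_).norm).pow 2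
      rw [closure_Qyl_zero hR]
      exact ⟨hx, ht'.1.le, ht'.2.le⟩
    exact (hcont.integrableOn_compact (isCompact_closedBall _ _)).mono_set
      Metric.ball_subset_closedBall
  refine (le_abs_self _).trans ((norm_setIntegral_le_of_norm_le_const (by simp) hbound).trans ?_)
  have hvol : volume.real (Ioo (-R ^ 2) (-R ^ 2 / 4)) ≤ R ^ 2 := by
    rw [Real.volume_real_Ioo_of_le (by linarith)]
    linarith
  calc R * AA u (0, 0) R * volume.real (Ioo (-R ^ 2) (-R ^ 2 / 4))
      ≤ R * AA u (0, 0) R * R ^ 2 :=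
        mul_le_mul_of_nonneg_left hvol (mul_nonneg hR.le (AA_nonneg u hR))
    _ = R ^ 3 * AA u (0, 0) R := by ring

/-- The weak formulation tested with the parabolic cutoff of scale `R`. -/
theorem integral_hfun_transportOp {u : E3 → ℝ → E3} {P : E3 → ℝ → ℝ} {U : Set (E3 × ℝ)}
    (hNS : IsNSQ1 u P U) {η θ : ℝ → ℝ} {C : ℝ} (H : IsCutoffPair η θ C) {R : ℝ} (hR : 0 < R)
    (hU : closure (Qyl (0, 0) R) ⊆ U) (hJ : 0 < JR u R) :
    IntegrableOn (fun z : E3 × ℝ => -(hfun u R z.1 z.2 * (transportOp (fun j z => u z.1 z.2 j)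
      (cutoff η θ R) z + 2 * (2 / R ^ 2 * cutoff (deriv η) θ R z)))) (cutoffCylinder R) ∧
    -4 * (∫ x : E3, deriv η (‖x‖ ^ 2)) * (∫ τ, θ τ) * R ^ 3 ≤
      ∫ z in cutoffCylinder R, -(hfun u R z.1 z.2 * (transportOp (fun j z => u z.1 z.2 j)
        (cutoff η θ R) z + 2 * (2 / R ^ 2 * cutoff (deriv η) θ R z))) := by
  obtain ⟨α, β, hα, hh⟩ := hfun_eq_affine hJ
  have dη := H.smooth_radial.differentiable (by simp)
  have dθ := H.smooth_time.differentiable (by simp)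
  have z0 := fun s hs => (H.radial_zero s hs).1
  have z1 := fun s hs => (H.radial_zero s hs).2.1
  have z2 := fun s hs => (H.radial_zero s hs).2.2
  have y0 := fun τ hτ => (H.time_zero τ hτ).1
  have y1 := fun τ hτ => (H.time_zero τ hτ).2
  have hφ : IsTestOn U (cutoff η θ R) :=
    isTestOn_cutoff H.smooth_radial H.smooth_time hR z0 y0 hU
  have hψ : IsTestOn U (cutoff (deriv η) θ R) :=
    isTestOn_cutoff H.smooth_radial.deriv' H.smooth_time hR z1 y0 hU
  obtain ⟨hF, hF0⟩ := hNS.isSpaceTimeNS.weak_affine_swirl hφ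
    (ψ := fun z => 2 / R ^ 2 * cutoff (deriv η) θ R z)
    (fun z i => fderiv_cutoff_spaceDir dη dθ R z i) α β
  have hψi : Integrable fun z => α * (2 * (2 / R ^ 2 * cutoff (deriv η) θ R z)) :=
    ((hψ.integrable.const_mul _).const_mul _).const_mul _
  have hG : Integrable fun z : E3 × ℝ => hfun u R z.1 z.2 *
      (transportOp (fun j z => u z.1 z.2 j) (cutoff η θ R) z
        + 2 * (2 / R ^ 2 * cutoff (deriv η) θ R z)) := by
    refine (hF.add hψi).congr (.of_forall fun z => ?_)
    simp [hh, Gam]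
  have hGv : ∫ z : E3 × ℝ, hfun u R z.1 z.2 *
      (transportOp (fun j z => u z.1 z.2 j) (cutoff η θ R) z
        + 2 * (2 / R ^ 2 * cutoff (deriv η) θ R z))
      = α * (4 * ((∫ x : E3, deriv η (‖x‖ ^ 2)) * (∫ τ, θ τ)) * R ^ 3) := by
    have e : ∫ z, α * (2 * (2 / R ^ 2 * cutoff (deriv η) θ R z))
        = α * (4 * ((∫ x : E3, deriv η (‖x‖ ^ 2)) * (∫ τ, θ τ)) * R ^ 3) := by
      rw [integral_const_mul, integral_const_mul, integral_const_mul, integral_cutoff _ _ hR]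
      field_simp
      ring
    rw [← e, ← sub_eq_zero, ← integral_sub hG hψi, ← hF0]
    simp [hh, Gam]
  refine ⟨hG.neg.integrableOn, ?_⟩
  rw [setIntegral_eq_integral_of_forall_compl_eq_zero, integral_neg, hGv]
  · have h1 := H.radial_integral
    have h2 := H.time_integral
    have h3 : 0 ≤ (-(∫ x : E3, deriv η (‖x‖ ^ 2)) * (∫ τ, θ τ)) * R ^ 3 * (α - 1) :=
      mul_nonneg (mul_nonneg (mul_nonneg (by linarith) h2.le) (by positivity)) (by linarith)
    nlinarith
  · intro z hz
    rw [transportOp_cutoff H.smooth_radial H.smooth_time, cutoff_eq_zero hR z0 y1 hz,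
      cutoff_eq_zero hR z1 y0 hz, cutoff_eq_zero hR z2 y0 hz]
    simp

/-- Absorption of the quadratic term by a suitable choice of the Young parameter. -/
theorem lower_bound_of_young {κ B A X : ℝ} (hκ : 0 < κ) (hB : 0 < B) (hA : 0 ≤ A)
    (h : ∀ ε, 0 < ε → κ ≤ B * (1 + 1 / (4 * ε)) * X + 2 * ε * B * A) :
    κ / (2 * B * (1 + B / κ)) * (1 + A)⁻¹ ≤ X := by
  have hA1 : 0 < 1 + A := by linarith
  have h1 := h (κ / (4 * B * (1 + A))) (by positivity)
  have e1 : 2 * (κ / (4 * B * (1 + A))) * B * A ≤ κ / 2 := by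
    have : 2 * (κ / (4 * B * (1 + A))) * B * A = κ / 2 * (A / (1 + A)) := by
      field_simp
      ring
    rw [this]
    exact mul_le_of_le_one_right (by positivity) ((div_le_one hA1).2 (by linarith))
  have e2 : B * (1 + 1 / (4 * (κ / (4 * B * (1 + A))))) = B * (1 + B * (1 + A) / κ) := by
    field_simp
  rw [e2] at h1
  have h2 : κ / 2 ≤ B * (1 + B * (1 + A) / κ) * X := by linarith
  have hX : 0 < X := pos_of_mul_pos_right (lt_of_lt_of_le (by positivity) h2) (by positivity)
  have h3 : B * (1 + B * (1 + A) / κ) ≤ B * (1 + B / κ) * (1 + A) := by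
    have : B * (1 + B / κ) * (1 + A) - B * (1 + B * (1 + A) / κ) = B * A := by
      field_simp
      ring
    nlinarith
  have h4 : κ / 2 ≤ B * (1 + B / κ) * (1 + A) * X :=
    h2.trans (mul_le_mul_of_nonneg_right h3 hX.le)
  rw [← div_eq_mul_inv, div_div, div_le_iff₀ (by positivity)]
  linarith

theorem setIntegral_hfun_ge {u : E3 → ℝ → E3} {P : E3 → ℝ → ℝ} {U : Set (E3 × ℝ)}
    (hNS : IsNSQ1 u P U) {η θ : ℝ → ℝ} {C : ℝ} (H : IsCutoffPair η θ C) {R : ℝ} (hR : 0 < R)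
    (hU : closure (Qyl (0, 0) R) ⊆ U) (hJ : 0 < JR u R) {ε : ℝ} (hε : 0 < ε) :
    -4 * (∫ x : E3, deriv η (‖x‖ ^ 2)) * (∫ τ, θ τ) ≤
      12 * C ^ 2 * (1 + 1 / (4 * ε)) * ((R ^ 5)⁻¹ * ∫ t in Ioo (-R ^ 2) (-R ^ 2 / 4),
        ∫ x in Metric.ball (0 : E3) (R / 2), hfun u R x t)
      + 2 * ε * (12 * C ^ 2) * AA u (0, 0) R := by
  obtain ⟨hI, hle⟩ := integral_hfun_transportOp hNS H hR hU hJ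
  have hu : ContinuousOn (fun z : E3 × ℝ => u z.1 z.2) (closure (Qyl (0, 0) R)) :=
    hNS.smooth_u.continuousOn.mono hU
  have hGc : ContinuousOn (fun z : E3 × ℝ => Gam u z.1 z.2) (closure (Qyl (0, 0) R)) := by
    have hc : ∀ j : Fin 3, ContinuousOn (fun z : E3 × ℝ => u z.1 z.2 j)
        (closure (Qyl (0, 0) R)) := fun j =>
      (hNS.isSpaceTimeNS.smooth j).continuousOn.mono hU
    exact ((contDiff_coord 0).continuous.continuousOn.mul (hc 1)).sub
      ((contDiff_coord 1).continuous.continuousOn.mul (hc 0))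
  obtain ⟨D, hD⟩ := (isCompact_closure_Qyl_zero hR).exists_bound_of_continuousOn hGc
  obtain ⟨α, β, -, hh⟩ := hfun_eq_affine hJ
  have hsub : cutoffCylinder R ⊆ closure (Qyl (0, 0) R) :=
    (cutoffCylinder_subset hR).trans subset_closure
  have hhi : IntegrableOn (fun z : E3 × ℝ => hfun u R z.1 z.2) (cutoffCylinder R) := by
    simp only [hh]
    exact ((continuousOn_const.add (continuousOn_const.mul hGc)).integrableOn_compact
      (isCompact_closure_Qyl_zero hR)).mono_set hsub
  have hui : IntegrableOn (fun z : E3 × ℝ => ‖u z.1 z.2‖ ^ 2) (cutoffCylinder R) :=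
    ((hu.norm.pow 2).integrableOn_compact (isCompact_closure_Qyl_zero hR)).mono_set hsub
  have hmeas : MeasurableSet (cutoffCylinder R) := measurableSet_ball.prod measurableSet_Ioo
  have hpt : ∀ z ∈ cutoffCylinder R, -(hfun u R z.1 z.2 *
      (transportOp (fun j z => u z.1 z.2 j) (cutoff η θ R) z
        + 2 * (2 / R ^ 2 * cutoff (deriv η) θ R z)))
      ≤ 12 * C ^ 2 * (1 + 1 / (4 * ε)) / R ^ 2 * hfun u R z.1 z.2
        + 2 * ε * (12 * C ^ 2) * ‖u z.1 z.2‖ ^ 2 := by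
    intro z hz
    obtain ⟨h0, h2⟩ := hfun_mem_Icc hJ (fun z hz => hD z (subset_closure hz))
      (cutoffCylinder_subset hR hz)
    have hin : |∑ i, u z.1 z.2 i * z.1 i| ≤ ‖u z.1 z.2‖ * ‖z.1‖ := by
      have := abs_real_inner_le_norm z.1 (u z.1 z.2)
      rw [PiLp.inner_apply] at this
      simpa [mul_comm] using this
    have hb := (neg_le_abs _).trans
      (abs_transportOp_cutoff_le H (fun j z => u z.1 z.2 j) hR hz hin)
    rw [abs_norm] at hb
    have hy : ‖u z.1 z.2‖ / R ≤ 1 / (4 * ε) / R ^ 2 + ε * ‖u z.1 z.2‖ ^ 2 := by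
      have : 1 / (4 * ε) / R ^ 2 + ε * ‖u z.1 z.2‖ ^ 2 - ‖u z.1 z.2‖ / R
          = (1 - 2 * ε * R * ‖u z.1 z.2‖) ^ 2 / (4 * ε * R ^ 2) := by
        field_simp
        ring
      have h3 : 0 ≤ (1 - 2 * ε * R * ‖u z.1 z.2‖) ^ 2 / (4 * ε * R ^ 2) := by positivity
      linarith
    have hsum : 12 / R ^ 2 + ‖u z.1 z.2‖ / R
        ≤ 12 * ((1 + 1 / (4 * ε)) / R ^ 2 + ε * ‖u z.1 z.2‖ ^ 2) := by
      have h4 : 0 ≤ ‖u z.1 z.2‖ / R := by positivity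
      have h5 : 12 * ((1 + 1 / (4 * ε)) / R ^ 2 + ε * ‖u z.1 z.2‖ ^ 2)
          = 12 / R ^ 2 + 12 * (1 / (4 * ε) / R ^ 2 + ε * ‖u z.1 z.2‖ ^ 2) := by ring
      linarith
    have hb' := hb.trans (mul_le_mul_of_nonneg_left hsum (sq_nonneg C))
    have hm := mul_le_mul_of_nonneg_left hb' h0
    have hlast : hfun u R z.1 z.2 * (12 * C ^ 2 * (ε * ‖u z.1 z.2‖ ^ 2))
        ≤ 2 * (12 * C ^ 2 * (ε * ‖u z.1 z.2‖ ^ 2)) :=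
      mul_le_mul_of_nonneg_right h2 (by positivity)
    rw [← mul_neg]
    refine hm.trans ?_
    calc _ = 12 * C ^ 2 * (1 + 1 / (4 * ε)) / R ^ 2 * hfun u R z.1 z.2
          + hfun u R z.1 z.2 * (12 * C ^ 2 * (ε * ‖u z.1 z.2‖ ^ 2)) := by ring
      _ ≤ _ := by linarith
  have hmono := setIntegral_mono_on hI ((hhi.const_mul _).add (hui.const_mul _)) hmeas hpt
  rw [integral_add' (hhi.const_mul _) (hui.const_mul _), integral_const_mul,
    integral_const_mul] at hmono
  have hA := mul_le_mul_of_nonneg_left (setIntegral_norm_sq_le hR hu)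
    (by positivity : 0 ≤ 2 * ε * (12 * C ^ 2))
  have htot := hle.trans (hmono.trans (add_le_add_right hA _))
  have hiter : ∫ z in cutoffCylinder R, hfun u R z.1 z.2
      = ∫ t in Ioo (-R ^ 2) (-R ^ 2 / 4), ∫ x in Metric.ball (0 : E3) (R / 2), hfun u R x t :=
    setIntegral_prod_symm_volume hhi
  rw [hiter] at htot
  refine le_of_mul_le_mul_right (htot.trans (le_of_eq ?_)) (by positivity : 0 < R ^ 3)
  field_simp

/-- initial lower bound on the average of `h`. -/
theorem initial_lower_bound :
    ∃ N₄ : ℝ, 0 < N₄ ∧ N₄ < 1 ∧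
      ∀ (u : E3 → ℝ → E3) (P : E3 → ℝ → ℝ) (U : Set (E3 × ℝ)),
        IsNSQ1 u P U → IsAxisym u P U →
        ∀ R : ℝ, 0 < R → R ≤ 1/4 → 0 < JR u R →
          N₄ * (1 + AA u (0, 0) R)⁻¹ ≤
            (R ^ 5)⁻¹ * ∫ t in Ioo (-R ^ 2) (-R ^ 2/4),
              ∫ x in Metric.ball (0:E3) (R/2), hfun u R x t := by
  obtain ⟨η, θ, C, H⟩ := exists_isCutoffPair
  set κ := -4 * (∫ x : E3, deriv η (‖x‖ ^ 2)) * (∫ τ, θ τ) with hκ_def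
  have hκ : 0 < κ := mul_pos (by linarith [H.radial_integral]) H.time_integral
  have hC : C ≠ 0 := by
    rintro rfl
    have : ∀ τ, θ τ = 0 := fun τ => abs_nonpos_iff.1 (H.time_bound τ).1
    simpa [this] using H.time_integral
  have hB : 0 < 12 * C ^ 2 := by positivity
  refine ⟨min (κ / (2 * (12 * C ^ 2) * (1 + 12 * C ^ 2 / κ))) (1 / 2), ?_, ?_, ?_⟩
  · exact lt_min (by positivity) (by norm_num)
  · exact (min_le_right _ _).trans_lt (by norm_num)
  · intro u P U hNS _ R hR hR4 hJ
    have hU : closure (Qyl (0, 0) R) ⊆ U := by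
      refine (closure_mono ?_).trans hNS.subset_U
      exact prod_mono (Metric.ball_subset_ball (by linarith))
        (Ioo_subset_Ioo_left (by simp only; nlinarith))
    have hA := AA_nonneg u hR
    have h := lower_bound_of_young hκ hB hA fun ε hε => setIntegral_hfun_ge hNS H hR hU hJ hε
    refine le_trans (mul_le_mul_of_nonneg_right (min_le_left _ _) ?_) h
    positivity
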